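/- Let X be a normed space over 𝔽 ∈ {ℝ, ℂ} of finite dimension n ≥ 3 and let x ∈ X be nonzero. Then x is a smooth point if and only if there exist nonzero vectors x₃, …, xₙ ∈ X such that (a) the intersection x^⊥ ∩ x₃^⊥ ∩ ⋯ ∩ xₙ^⊥ is a single line 𝔽v for some nonzero v, and (b) for every index i ∈ {3, …, n}, if one sets Ω_i := { y ∈ X \ {0} : x^⊥ ∩ y^⊥ ∩ ⋂_{j ∈ {3,…,n}, j ≠ i} x_j^⊥ is a single line }, then x^⊥ ∩ ⋂_{j ∈ {3,…,n}, j ≠ i} x_j^⊥ ∩ ⋂_{y ∈ Ω_i} y^⊥ = {0}. -/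

import Mathlib

/-- Birkhoff–James orthogonality. -/
def BJOrtho (𝕜 : Type*) [RCLike 𝕜] {X : Type*} [NormedAddCommGroup X] [NormedSpace 𝕜 X]
    (x y : X) : Prop :=
  ∀ c : 𝕜, ‖x‖ ≤ ‖x + c • y‖

/-- `f` is a supporting functional of `x`. -/
def IsSuppFun (𝕜 : Type*) [RCLike 𝕜] {X : Type*} [NormedAddCommGroup X] [NormedSpace 𝕜 X]
    (f : X →L[𝕜] 𝕜) (x : X) : Prop :=
  ‖f‖ = 1 ∧ f x = (‖x‖ : 𝕜)

/-- `x` is a smooth point: it is nonzero and has exactly one supporting functional. -/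
def IsSmoothPt (𝕜 : Type*) [RCLike 𝕜] {X : Type*} [NormedAddCommGroup X] [NormedSpace 𝕜 X]
    (x : X) : Prop :=
  x ≠ 0 ∧ ∃! f : X →L[𝕜] 𝕜, IsSuppFun 𝕜 f x

/-- A subset of `X` is a single line if it equals `𝕜 v` for some nonzero vector `v`. -/
def IsLine (𝕜 : Type*) [RCLike 𝕜] {X : Type*} [NormedAddCommGroup X] [NormedSpace 𝕜 X]
    (S : Set X) : Prop :=
  ∃ v : X, v ≠ 0 ∧ S = {y : X | ∃ c : 𝕜, y = c • v}

section Support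

variable {𝕜 X : Type*} [RCLike 𝕜] [NormedAddCommGroup X] [NormedSpace 𝕜 X]

theorem IsSuppFun.bjOrtho {f : X →L[𝕜] 𝕜} {x y : X} (hf : IsSuppFun 𝕜 f x) (hy : f y = 0) :
    BJOrtho 𝕜 x y := by
  intro c
  have h := f.le_opNorm (x + c • y)
  simpa [hf.1, hf.2, hy] using h

theorem exists_isSuppFun {x : X} (hx : x ≠ 0) : ∃ f : X →L[𝕜] 𝕜, IsSuppFun 𝕜 f x :=
  exists_dual_vector 𝕜 x (norm_ne_zero_iff.2 hx)

/-- Birkhoff–James orthogonality to `y` is witnessed by a supporting functional killing `y`. -/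
theorem BJOrtho.exists_isSuppFun {x y : X} (hx : x ≠ 0) (h : BJOrtho 𝕜 x y) :
    ∃ f : X →L[𝕜] 𝕜, IsSuppFun 𝕜 f x ∧ f y = 0 := by
  let S : Submodule 𝕜 X := 𝕜 ∙ y
  have hx' : ‖(S.mkQ x : X ⧸ S)‖ = ‖x‖ := by
    refine le_antisymm (Submodule.Quotient.norm_mk_le S x) ?_
    refine (QuotientAddGroup.le_norm_iff (S := S.toAddSubgroup) (x := (S.mkQ x : X ⧸ S))).2 ?_
    intro m hm
    have hm' : m - x ∈ S := (Submodule.Quotient.eq S).1 hm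
    obtain ⟨c, hc⟩ := Submodule.mem_span_singleton.1 hm'
    simpa [hc] using h c
  obtain ⟨g, hg, hgx⟩ := exists_dual_vector 𝕜 (S.mkQ x) (by rwa [hx', norm_ne_zero_iff])
  have hbound : ∀ z, ‖(g.toLinearMap ∘ₗ S.mkQ) z‖ ≤ 1 * ‖z‖ := fun z => by
    have h1 := g.le_opNorm (S.mkQ z)
    rw [hg] at h1
    exact h1.trans (by gcongr; exact Submodule.Quotient.norm_mk_le S z)
  let f : X →L[𝕜] 𝕜 := (g.toLinearMap ∘ₗ S.mkQ).mkContinuous 1 hbound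
  have hfx : f x = (‖x‖ : 𝕜) := by
    change g (S.mkQ x) = _
    rw [hgx, hx']
  refine ⟨f, ⟨le_antisymm (LinearMap.mkContinuous_norm_le _ zero_le_one _) ?_, hfx⟩, ?_⟩
  · have h1 := f.le_opNorm x
    rw [hfx, RCLike.norm_ofReal, abs_norm] at h1
    exact le_of_mul_le_mul_right ((one_mul ‖x‖).trans_le h1) (norm_pos_iff.2 hx)
  · change g (S.mkQ y) = 0
    rw [Submodule.mkQ_apply,
      (Submodule.Quotient.mk_eq_zero S).2 (Submodule.mem_span_singleton_self y), map_zero]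

theorem IsSmoothPt.bjOrtho_iff {f : X →L[𝕜] 𝕜} {x y : X} (hx : IsSmoothPt 𝕜 x)
    (hf : IsSuppFun 𝕜 f x) : BJOrtho 𝕜 x y ↔ f y = 0 := by
  refine ⟨fun h => ?_, hf.bjOrtho⟩
  obtain ⟨g, hg, hgy⟩ := h.exists_isSuppFun hx.1
  rwa [hx.2.unique hf hg]

theorem IsSuppFun.re_eq_fderiv_norm [NormedSpace ℝ X] [IsScalarTower ℝ 𝕜 X] {f : X →L[𝕜] 𝕜}
    {z : X} (hf : IsSuppFun 𝕜 f z) (hz : DifferentiableAt ℝ (fun w : X => ‖w‖) z) (y : X) :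
    RCLike.re (f y) = fderiv ℝ (fun w : X => ‖w‖) z y := by
  let R : X →L[ℝ] ℝ := RCLike.reCLM.comp (f.restrictScalars ℝ)
  have hmin : IsLocalMin (fun w : X => ‖w‖ - R w) z := by
    refine Filter.Eventually.of_forall fun w => ?_
    have h1 : R z = ‖z‖ := by simp [R, hf.2]
    have h2 : R w ≤ ‖w‖ := by
      have h3 := f.le_opNorm w
      rw [hf.1, one_mul] at h3
      exact (RCLike.re_le_norm (f w)).trans h3
    simp only [h1, sub_self, sub_nonneg, h2]
  have h0 := hmin.hasFDerivAt_eq_zero (hz.hasFDerivAt.sub R.hasFDerivAt)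
  have h1 := DFunLike.congr_fun h0 y
  simp only [sub_apply, zero_apply, sub_eq_zero] at h1
  simpa [R] using h1.symm

theorem isSmoothPt_of_differentiableAt_norm [NormedSpace ℝ X] [IsScalarTower ℝ 𝕜 X]
    {z : X} (h0 : z ≠ 0) (hz : DifferentiableAt ℝ (fun w : X => ‖w‖) z) : IsSmoothPt 𝕜 z := by
  refine ⟨h0, existsUnique_of_exists_of_unique (exists_isSuppFun h0) fun f g hf hg => ?_⟩
  have hre : ∀ y, RCLike.re (f y - g y) = 0 := fun y => by
    rw [map_sub, hf.re_eq_fderiv_norm hz, hg.re_eq_fderiv_norm hz, sub_self]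
  ext y
  have h1 := hre ((starRingEnd 𝕜) (f y - g y) • y)
  rw [map_smul, map_smul, ← smul_sub, smul_eq_mul, RCLike.conj_mul, ← RCLike.ofReal_pow,
    RCLike.ofReal_re] at h1
  exact sub_eq_zero.1 (norm_eq_zero.1 (by simpa using h1))

/-- The supporting functionals of the smooth points separate points. -/
theorem exists_isSmoothPt_apply_ne_zero [FiniteDimensional 𝕜 X] {w : X} (hw : w ≠ 0) :
    ∃ (z : X) (f : X →L[𝕜] 𝕜), IsSmoothPt 𝕜 z ∧ IsSuppFun 𝕜 f z ∧ f w ≠ 0 := by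
  let _ : NormedSpace ℝ X := NormedSpace.restrictScalars ℝ 𝕜 X
  have _ : IsScalarTower ℝ 𝕜 X := ⟨fun a b c => by
    change (a • b) • c = (algebraMap ℝ 𝕜 a) • (b • c)
    rw [smul_smul, Algebra.smul_def]⟩
  have _ : FiniteDimensional ℝ X := FiniteDimensional.trans ℝ 𝕜 X
  have hpos : 0 < ‖w‖ / 2 := half_pos (norm_pos_iff.2 hw)
  obtain ⟨z, hz, hzw⟩ := (dense_differentiableAt_norm (E := X)).exists_dist_lt w hpos
  rw [dist_eq_norm] at hzw
  have hnorm : ‖w‖ / 2 < ‖z‖ := by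
    have := norm_sub_norm_le w z
    linarith
  have hz0 : z ≠ 0 := norm_pos_iff.1 (hpos.trans hnorm)
  obtain ⟨f, hf⟩ := exists_isSuppFun (𝕜 := 𝕜) hz0
  refine ⟨z, f, isSmoothPt_of_differentiableAt_norm hz0 hz, hf, fun hfw => ?_⟩
  have h1 := f.le_opNorm (w - z)
  rw [map_sub, hfw, hf.1, hf.2, zero_sub, norm_neg, RCLike.norm_ofReal, abs_norm, one_mul] at h1
  linarith

end Support

section Kernels

variable {K V ι : Type*} [Field K] [AddCommGroup V] [Module K V] [FiniteDimensional K V]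

theorem exists_ne_zero_forall_apply_eq_zero [Fintype ι] (f : Module.Dual K V)
    (F : ι → Module.Dual K V) (h : Fintype.card ι + 1 < Module.finrank K V) :
    ∃ u ≠ 0, f u = 0 ∧ ∀ i, F i u = 0 := by
  let L : V →ₗ[K] K × (ι → K) := f.prod (LinearMap.pi F)
  have hL : LinearMap.ker L ≠ ⊥ := by
    refine L.ker_ne_bot_of_finrank_lt ?_
    rw [Module.finrank_prod, Module.finrank_self, Module.finrank_fintype_fun_eq_card]
    omega
  obtain ⟨u, hu, hu0⟩ := (Submodule.ne_bot_iff _).1 hL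
  have hu' : L u = 0 := hu
  exact ⟨u, hu0, congrArg Prod.fst hu', fun i => congrFun (congrArg Prod.snd hu') i⟩

theorem finrank_inf_ker_lt {p : Submodule K V} {g : Module.Dual K V} {w : V} (hw : w ∈ p)
    (hg : g w ≠ 0) :
    Module.finrank K (p ⊓ LinearMap.ker g : Submodule K V) < Module.finrank K p := by
  refine Submodule.finrank_lt_finrank_of_lt (lt_of_le_of_ne inf_le_left fun h => hg ?_)
  rw [← h] at hw
  exact hw.2

theorem finrank_le_finrank_inf_ker_add_one (p : Submodule K V) (g : Module.Dual K V) :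
    Module.finrank K p ≤ Module.finrank K (p ⊓ LinearMap.ker g : Submodule K V) + 1 := by
  have h1 := Submodule.finrank_sup_add_finrank_inf_eq p (LinearMap.ker g)
  have h2 := g.finrank_range_add_finrank_ker
  have h3 := Submodule.finrank_le (LinearMap.range g)
  have h4 := Submodule.finrank_le (p ⊔ LinearMap.ker g)
  rw [Module.finrank_self] at h3
  omega

theorem eq_span_singleton_of_finrank_le_one {p : Submodule K V}
    (hp : Module.finrank K p ≤ 1) {u : V} (hu : u ∈ p) (hu0 : u ≠ 0) : p = K ∙ u := by
  refine (Submodule.eq_of_le_of_finrank_le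
    ((Submodule.span_singleton_le_iff_mem _ _).2 hu) ?_).symm
  rwa [finrank_span_singleton hu0]

end Kernels

section Lines

variable {𝕜 X ι : Type*} [RCLike 𝕜] [NormedAddCommGroup X] [NormedSpace 𝕜 X]

/-- The common right orthogonal complement of a point and a family of points. -/
def commonOrtho (𝕜 : Type*) [RCLike 𝕜] {X ι : Type*} [NormedAddCommGroup X] [NormedSpace 𝕜 X]
    (x : X) (v : ι → X) : Set X :=
  {y | BJOrtho 𝕜 x y ∧ ∀ i, BJOrtho 𝕜 (v i) y}

theorem inter_iInter_eq_commonOrtho (x : X) (v : ι → X) :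
    ({y : X | BJOrtho 𝕜 x y} ∩ ⋂ i, {y : X | BJOrtho 𝕜 (v i) y}) = commonOrtho 𝕜 x v := by
  ext y
  simp [commonOrtho]

theorem inter_inter_iInter_eq_commonOrtho_update [DecidableEq ι] (x y : X) (v : ι → X) (i : ι) :
    ({w : X | BJOrtho 𝕜 x w} ∩ {w : X | BJOrtho 𝕜 y w} ∩
      ⋂ j ∈ {j | j ≠ i}, {w : X | BJOrtho 𝕜 (v j) w}) =
      commonOrtho 𝕜 x (Function.update v i y) := by
  ext w
  simp [commonOrtho, Function.forall_update_iff v (fun _ a => BJOrtho 𝕜 a w), and_assoc]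

/-- The common kernel of a functional and a family of functionals. -/
def commonKer (f : X →L[𝕜] 𝕜) (F : ι → X →L[𝕜] 𝕜) : Submodule 𝕜 X :=
  LinearMap.ker f.toLinearMap ⊓ ⨅ i, LinearMap.ker (F i).toLinearMap

theorem mem_commonKer {f : X →L[𝕜] 𝕜} {F : ι → X →L[𝕜] 𝕜} {y : X} :
    y ∈ commonKer f F ↔ f y = 0 ∧ ∀ i, F i y = 0 := by
  simp [commonKer]

theorem commonKer_subset_commonOrtho {f : X →L[𝕜] 𝕜} {F : ι → X →L[𝕜] 𝕜} {x : X} {v : ι → X}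
    (hf : IsSuppFun 𝕜 f x) (hF : ∀ i, IsSuppFun 𝕜 (F i) (v i)) :
    (commonKer f F : Set X) ⊆ commonOrtho 𝕜 x v := fun _ hy =>
  ⟨hf.bjOrtho (mem_commonKer.1 hy).1, fun i => (hF i).bjOrtho ((mem_commonKer.1 hy).2 i)⟩

theorem commonOrtho_eq_commonKer {f : X →L[𝕜] 𝕜} {F : ι → X →L[𝕜] 𝕜} {x : X} {v : ι → X}
    (hx : IsSmoothPt 𝕜 x) (hv : ∀ i, IsSmoothPt 𝕜 (v i))
    (hf : IsSuppFun 𝕜 f x) (hF : ∀ i, IsSuppFun 𝕜 (F i) (v i)) :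
    commonOrtho 𝕜 x v = commonKer f F := by
  ext y
  refine Iff.trans ?_ mem_commonKer.symm
  exact and_congr (hx.bjOrtho_iff hf) (forall_congr' fun i => (hv i).bjOrtho_iff (hF i))

variable [FiniteDimensional 𝕜 X]

/-- Replacing one functional by another one that does not vanish at some common zero of the
remaining functionals does not increase the dimension of a common kernel of dimension one. -/
theorem finrank_commonKer_update_le_one [DecidableEq ι] {f : X →L[𝕜] 𝕜} {F : ι → X →L[𝕜] 𝕜}
    (h : Module.finrank 𝕜 (commonKer f F) ≤ 1) {i : ι} {g : X →L[𝕜] 𝕜} {w : X} (hfw : f w = 0)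
    (hFw : ∀ j ≠ i, F j w = 0) (hgw : g w ≠ 0) :
    Module.finrank 𝕜 (commonKer f (Function.update F i g)) ≤ 1 := by
  have key : ∀ g' : X →L[𝕜] 𝕜, commonKer f (Function.update F i g') =
      commonKer f (Function.update F i 0) ⊓ LinearMap.ker g'.toLinearMap := fun g' => by
    ext y
    simp only [mem_commonKer, Submodule.mem_inf,
      Function.forall_update_iff F (fun _ φ => φ y = 0)]
    simp
    tauto
  have h1 := key (F i)
  rw [Function.update_eq_self] at h1
  have h2 := finrank_le_finrank_inf_ker_add_one (commonKer f (Function.update F i 0))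
    (F i).toLinearMap
  have hw : w ∈ commonKer f (Function.update F i 0) := by
    rw [mem_commonKer, Function.forall_update_iff F (fun _ φ => φ w = 0)]
    exact ⟨hfw, by simp, hFw⟩
  have h3 := finrank_inf_ker_lt (g := g.toLinearMap) hw hgw
  rw [key g]
  rw [← h1] at h2
  omega

variable [Fintype ι]

theorem exists_ne_zero_mem_commonKer (hn : Fintype.card ι + 1 < Module.finrank 𝕜 X)
    (f : X →L[𝕜] 𝕜) (F : ι → X →L[𝕜] 𝕜) : ∃ u ≠ 0, u ∈ commonKer f F := by
  obtain ⟨u, hu, h⟩ := exists_ne_zero_forall_apply_eq_zero f.toLinearMap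
    (fun i => (F i).toLinearMap) hn
  exact ⟨u, hu, mem_commonKer.2 h⟩

theorem isLine_commonKer (hn : Fintype.card ι + 1 < Module.finrank 𝕜 X) {f : X →L[𝕜] 𝕜}
    {F : ι → X →L[𝕜] 𝕜} (h : Module.finrank 𝕜 (commonKer f F) ≤ 1) :
    IsLine 𝕜 (commonKer f F : Set X) := by
  obtain ⟨u, hu0, hu⟩ := exists_ne_zero_mem_commonKer hn f F
  refine ⟨u, hu0, ?_⟩
  rw [eq_span_singleton_of_finrank_le_one h hu hu0]
  ext y
  simp [Submodule.mem_span_singleton, eq_comm]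

/-- If the common orthogonal complement is a line, then it lies in the common kernel of any
choice of supporting functionals. -/
theorem mem_commonKer_of_commonOrtho_eq (hn : Fintype.card ι + 1 < Module.finrank 𝕜 X)
    {f : X →L[𝕜] 𝕜} {F : ι → X →L[𝕜] 𝕜} {x w : X} {v : ι → X}
    (hf : IsSuppFun 𝕜 f x) (hF : ∀ i, IsSuppFun 𝕜 (F i) (v i))
    (h : commonOrtho 𝕜 x v = {y : X | ∃ c : 𝕜, y = c • w}) : w ∈ commonKer f F := by
  obtain ⟨u, hu0, hu⟩ := exists_ne_zero_mem_commonKer hn f F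
  have hu' := commonKer_subset_commonOrtho hf hF hu
  rw [h] at hu'
  obtain ⟨c, rfl⟩ := hu'
  exact (Submodule.smul_mem_iff _ (left_ne_zero_of_smul hu0)).1 hu

/-- A supporting functional of `x` can be complemented by supporting functionals of smooth points
so that the common kernel drops in dimension at each step. -/
theorem exists_isSmoothPt_finrank_commonKer_le {f : X →L[𝕜] 𝕜} (hf : f ≠ 0) (k : ℕ) :
    ∃ (v : Fin k → X) (F : Fin k → X →L[𝕜] 𝕜), (∀ i, IsSmoothPt 𝕜 (v i)) ∧
      (∀ i, IsSuppFun 𝕜 (F i) (v i)) ∧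
      Module.finrank 𝕜 (commonKer f F) ≤ Module.finrank 𝕜 X - (k + 1) := by
  induction k with
  | zero =>
    refine ⟨Fin.elim0, Fin.elim0, fun i => i.elim0, fun i => i.elim0, ?_⟩
    obtain ⟨w, hw⟩ := DFunLike.ne_iff.1 hf
    have h := finrank_inf_ker_lt (p := ⊤) (g := f.toLinearMap) (Submodule.mem_top (x := w)) hw
    have h' : commonKer f Fin.elim0 = ⊤ ⊓ LinearMap.ker f.toLinearMap := by
      ext y
      simp [mem_commonKer]
    rw [h']
    rw [finrank_top] at h
    omega
  | succ k ih =>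
    obtain ⟨v, F, hv, hF, hdim⟩ := ih
    by_cases hbot : commonKer f F = ⊥
    · obtain ⟨w, hw⟩ := DFunLike.ne_iff.1 hf
      obtain ⟨z, g, hz, hg, -⟩ := exists_isSmoothPt_apply_ne_zero (𝕜 := 𝕜) (w := w)
        (by rintro rfl; simp at hw)
      refine ⟨Fin.cons z v, Fin.cons g F, Fin.cases hz hv, Fin.cases hg hF, ?_⟩
      have h' : commonKer f (Fin.cons g F : Fin (k + 1) → X →L[𝕜] 𝕜) = ⊥ := by
        refine le_bot_iff.1 (le_trans (fun y hy => ?_) hbot.le)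
        rw [mem_commonKer, Fin.forall_fin_succ] at hy
        exact mem_commonKer.2 ⟨hy.1, hy.2.2⟩
      rw [h', finrank_bot]
      exact Nat.zero_le _
    · obtain ⟨w, hw, hw0⟩ := (Submodule.ne_bot_iff _).1 hbot
      obtain ⟨z, g, hz, hg, hgw⟩ := exists_isSmoothPt_apply_ne_zero (𝕜 := 𝕜) hw0
      refine ⟨Fin.cons z v, Fin.cons g F, Fin.cases hz hv, Fin.cases hg hF, ?_⟩
      have h' : commonKer f (Fin.cons g F : Fin (k + 1) → X →L[𝕜] 𝕜) =
          commonKer f F ⊓ LinearMap.ker g.toLinearMap := by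
        ext y
        simp [mem_commonKer, Fin.forall_fin_succ]
        tauto
      have := finrank_inf_ker_lt (g := g.toLinearMap) hw hgw
      rw [h']
      omega

/-- If the common orthogonal complement of `x` and the `v i` is the line `𝕜 w` and `x` has two
supporting functionals, then for some `i` the line persists as the common orthogonal complement
of `x` and any family obtained by replacing `v i`, whenever that is a line. -/
theorem exists_forall_bjOrtho_of_not_unique [DecidableEq ι]
    (hn : Fintype.card ι + 1 < Module.finrank 𝕜 X) {f g : X →L[𝕜] 𝕜} {x w : X} {v : ι → X}
    (hx : x ≠ 0) (hv : ∀ i, v i ≠ 0) (hf : IsSuppFun 𝕜 f x) (hg : IsSuppFun 𝕜 g x) (hfg : f ≠ g)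
    (h : commonOrtho 𝕜 x v = {y : X | ∃ c : 𝕜, y = c • w}) :
    ∃ i, ∀ y ≠ 0, IsLine 𝕜 (commonOrtho 𝕜 x (Function.update v i y)) → BJOrtho 𝕜 y w := by
  choose F hF using fun i => exists_isSuppFun (𝕜 := 𝕜) (hv i)
  have hwg := mem_commonKer_of_commonOrtho_eq hn hg hF h
  have hsub : ∀ u ∈ commonKer f F, ∃ c : 𝕜, u = c • w := fun u hu => by
    have := commonKer_subset_commonOrtho hf hF hu
    rwa [h] at this
  let φ : Option ι → Module.Dual 𝕜 X := fun o => o.elim f.toLinearMap fun i => (F i).toLinearMap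
  have hspan : g.toLinearMap ∈ Submodule.span 𝕜 (Set.range φ) := by
    refine mem_span_of_iInf_ker_le_ker fun u hu => ?_
    simp only [Submodule.mem_iInf, LinearMap.mem_ker, Option.forall, φ, Option.elim] at hu
    obtain ⟨c, rfl⟩ := hsub u (mem_commonKer.2 hu)
    exact Submodule.smul_mem _ c (mem_commonKer.1 hwg).1
  obtain ⟨a, ha⟩ := (Submodule.mem_span_range_iff_exists_fun 𝕜).1 hspan
  have hga : ∀ u, g u = a none * f u + ∑ i, a (some i) * F i u := fun u => by
    have := LinearMap.congr_fun ha u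
    simp [Fintype.sum_option, φ] at this
    exact this.symm
  have hne : ∃ i, a (some i) ≠ 0 := by
    by_contra! hall
    have hx' : (‖x‖ : 𝕜) ≠ 0 := by simpa using hx
    have h1 := hga x
    simp only [hall, zero_mul, Finset.sum_const_zero, add_zero, hf.2, hg.2] at h1
    have h2 : a none = 1 := mul_right_cancel₀ hx' (by rw [one_mul, ← h1])
    refine hfg (ContinuousLinearMap.ext fun u => ?_)
    simp [hga u, hall, h2]
  obtain ⟨i, hi⟩ := hne
  refine ⟨i, fun y hy ⟨u, hu0, hu⟩ => ?_⟩
  obtain ⟨p, hp⟩ := exists_isSuppFun (𝕜 := 𝕜) hy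
  have hF' : ∀ j, IsSuppFun 𝕜 (Function.update F i p j) (Function.update v i y j) := fun j => by
    by_cases hj : j = i
    · subst hj
      simpa using hp
    · simpa [hj] using hF j
  have huf := mem_commonKer.1 (mem_commonKer_of_commonOrtho_eq hn hf hF' hu)
  have hug := mem_commonKer.1 (mem_commonKer_of_commonOrtho_eq hn hg hF' hu)
  rw [Function.forall_update_iff F (fun _ φ => φ u = 0)] at huf
  have hFi : F i u = 0 := by
    have h1 := hga u
    rw [hug.1, huf.1, mul_zero, zero_add, Finset.sum_eq_single i
      (fun j _ hj => by rw [huf.2.2 j hj, mul_zero]) (by simp)] at h1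
    exact (mul_eq_zero.1 h1.symm).resolve_left hi
  obtain ⟨c, hc⟩ := hsub u (mem_commonKer.2 ⟨huf.1, fun j => by
    by_cases hj : j = i
    · rwa [hj]
    · exact huf.2.2 j hj⟩)
  refine hp.bjOrtho ?_
  have h1 := huf.2.1
  rw [hc, map_smul, smul_eq_mul] at h1
  exact (mul_eq_zero.1 h1).resolve_left (left_ne_zero_of_smul (hc ▸ hu0))

end Lines

/-- In a normed space of finite dimension `n ≥ 3`, a nonzero point `x` is smooth iff there are
nonzero vectors `x₃, …, xₙ` such that `x^⊥ ∩ x₃^⊥ ∩ ⋯ ∩ xₙ^⊥` is a single line and, for every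
index `i`, setting `Ω_i = {y ≠ 0 : x^⊥ ∩ y^⊥ ∩ ⋂_{j ≠ i} x_j^⊥ is a single line}`, one has
`x^⊥ ∩ ⋂_{j ≠ i} x_j^⊥ ∩ ⋂_{y ∈ Ω_i} y^⊥ = {0}`. -/
theorem stmt9 {𝕜 X : Type*} [RCLike 𝕜] [NormedAddCommGroup X] [NormedSpace 𝕜 X]
    [FiniteDimensional 𝕜 X] (hn : 3 ≤ Module.finrank 𝕜 X) (x : X) (hx : x ≠ 0) :
    IsSmoothPt 𝕜 x ↔
    ∃ v : Fin (Module.finrank 𝕜 X - 2) → X,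
      (∀ i, v i ≠ 0) ∧
      IsLine 𝕜 ({y : X | BJOrtho 𝕜 x y} ∩ ⋂ i, {y : X | BJOrtho 𝕜 (v i) y}) ∧
      ∀ i : Fin (Module.finrank 𝕜 X - 2),
        ({y : X | BJOrtho 𝕜 x y} ∩ (⋂ j ∈ {j | j ≠ i}, {y : X | BJOrtho 𝕜 (v j) y}) ∩
          ⋂ y ∈ {y : X | y ≠ 0 ∧
              IsLine 𝕜 ({w : X | BJOrtho 𝕜 x w} ∩ {w : X | BJOrtho 𝕜 y w} ∩
                ⋂ j ∈ {j | j ≠ i}, {w : X | BJOrtho 𝕜 (v j) w})},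
            {w : X | BJOrtho 𝕜 y w}) = {0} := by
  classical
  have hcard : Fintype.card (Fin (Module.finrank 𝕜 X - 2)) + 1 < Module.finrank 𝕜 X := by
    rw [Fintype.card_fin]
    omega
  simp only [inter_iInter_eq_commonOrtho, inter_inter_iInter_eq_commonOrtho_update]
  constructor
  · intro hsm
    obtain ⟨f, hf⟩ := exists_isSuppFun (𝕜 := 𝕜) hx
    have hf0 : f ≠ 0 := norm_ne_zero_iff.1 (by rw [hf.1]; exact one_ne_zero)
    obtain ⟨v, F, hv, hF, hdim⟩ :=
      exists_isSmoothPt_finrank_commonKer_le hf0 (Module.finrank 𝕜 X - 2)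
    replace hdim : Module.finrank 𝕜 (commonKer f F) ≤ 1 := hdim.trans (by omega)
    refine ⟨v, fun i => (hv i).1, ?_, fun i => ?_⟩
    · rw [commonOrtho_eq_commonKer hsm hv hf hF]
      exact isLine_commonKer hcard hdim
    · refine Set.Subset.antisymm (fun w hw => ?_) ?_
      · simp only [Set.mem_inter_iff, Set.mem_iInter, Set.mem_ofPred_eq] at hw
        obtain ⟨⟨hxw, hvw⟩, hΩ⟩ := hw
        by_contra hw0
        obtain ⟨z, g, hz, hg, hgw⟩ := exists_isSmoothPt_apply_ne_zero (𝕜 := 𝕜) (w := w) hw0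
        refine hgw ((hz.bjOrtho_iff hg).1 (hΩ z ⟨hz.1, ?_⟩))
        have hsupp : ∀ j, IsSmoothPt 𝕜 (Function.update v i z j) ∧
            IsSuppFun 𝕜 (Function.update F i g j) (Function.update v i z j) := fun j => by
          by_cases hj : j = i
          · subst hj
            simpa using ⟨hz, hg⟩
          · simpa [hj] using ⟨hv j, hF j⟩
        rw [commonOrtho_eq_commonKer hsm (fun j => (hsupp j).1) hf fun j => (hsupp j).2]
        exact isLine_commonKer hcard (finrank_commonKer_update_le_one hdim
          ((hsm.bjOrtho_iff hf).1 hxw) (fun j hj => ((hv j).bjOrtho_iff (hF j)).1 (hvw j hj)) hgw)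
      · rintro _ rfl
        simp [BJOrtho]
  · rintro ⟨v, hv, ⟨w, hw0, hw⟩, hΩ⟩
    refine ⟨hx, existsUnique_of_exists_of_unique (exists_isSuppFun hx) fun f g hf hg => ?_⟩
    by_contra hfg
    obtain ⟨i, hi⟩ := exists_forall_bjOrtho_of_not_unique hcard hx hv hf hg hfg hw
    have hwmem : w ∈ commonOrtho 𝕜 x v := hw ▸ ⟨1, (one_smul 𝕜 w).symm⟩
    refine hw0 (Set.mem_singleton_iff.1 (hΩ i ▸ ?_))
    simp only [Set.mem_inter_iff, Set.mem_iInter, Set.mem_ofPred_eq]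
    exact ⟨⟨hwmem.1, fun j _ => hwmem.2 j⟩, fun y hy => hi y hy.1 hy.2⟩
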